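/- Let E = {n² : n ∈ ℕ, n ≥ 1} and P = ℕ \ E. Then P is a Δ*-set (it meets every Δ-set), yet the topological entropy h_{σ_P} of the spacing shift (Σ_P, σ_P) is zero. In particular, P being a Δ*-set is not sufficient for positive entropy. -/

import Mathlib

open Filter Topology

/-- The spacing shift `Σ_P ⊆ {0,1}^ℕ` determined by `P ⊆ ℕ`: a `0`-`1` sequence `x`
(encoded as `x : ℕ → Bool`) belongs to `Σ_P` iff whenever two coordinates are `1`,
the (positive) distance between them lies in `P`. -/
def SpacingShift (P : Set ℕ) : Set (ℕ → Bool) :=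
  {x | ∀ i j : ℕ, i < j → x i = true → x j = true → j - i ∈ P}

/-- The left shift map `σ` on sequences. -/
def shift (x : ℕ → Bool) : ℕ → Bool := fun n => x (n + 1)

/-- The support `A_y = {i : y_i = 1}` of a point of the shift space. -/
def supp (x : ℕ → Bool) : Set ℕ := {i | x i = true}

/-- `A ⊆ ℕ` has density `d`, i.e. `|A ∩ {1,…,n}| / n → d`. -/
def HasDensity (A : Set ℕ) (d : ℝ) : Prop :=
  Tendsto (fun n : ℕ => (Nat.card (A ∩ Set.Icc 1 n : Set ℕ) : ℝ) / n) atTop (𝓝 d)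

/-- The upper density `d̄(A) = limsup_n |A ∩ {1,…,n}| / n`. -/
noncomputable def upperDensity (A : Set ℕ) : ℝ :=
  limsup (fun n : ℕ => (Nat.card (A ∩ Set.Icc 1 n : Set ℕ) : ℝ) / n) atTop

/-- The upper Banach density `d*(A)`: the limsup, as the window length tends to infinity,
of the maximal proportion of elements of `A` in a window of that length. -/
noncomputable def upperBanachDensity (A : Set ℕ) : ℝ :=
  limsup (fun n : ℕ =>
    ⨆ m : ℕ, (Nat.card (A ∩ Set.Icc m (m + n) : Set ℕ) : ℝ) / (n + 1)) atTop

/-- `D ⊆ ℕ` is a Δ-set: it contains the difference set `{s_i - s_j : i > j}` of some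
strictly increasing sequence of natural numbers. -/
def IsDeltaSet (D : Set ℕ) : Prop :=
  ∃ s : ℕ → ℕ, StrictMono s ∧ ∀ i j : ℕ, j < i → s i - s j ∈ D

/-- `D ⊆ ℕ` is a Δ*-set: it meets every Δ-set. -/
def IsDeltaStarSet (D : Set ℕ) : Prop :=
  ∀ D' : Set ℕ, IsDeltaSet D' → (D ∩ D').Nonempty

open Classical in
/-- The standard metric on the shift space: `d(x,y) = 2^{-min{n : x_n ≠ y_n}}`,
and `d(x,x) = 0`. -/
noncomputable def seqDist (x y : ℕ → Bool) : ℝ :=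
  if x = y then 0 else (2 : ℝ)⁻¹ ^ sInf {n : ℕ | x n ≠ y n}

/-- The set `FS((a_n))` of finite sums of a sequence of natural numbers:
all sums `a_{i_1} + ⋯ + a_{i_k}` with `i_1 < ⋯ < i_k`. -/
def FSseq (a : ℕ → ℕ) : Set ℕ :=
  {n | ∃ F : Finset ℕ, F.Nonempty ∧ n = ∑ i ∈ F, a i}

/-- `S ⊆ ℕ` is an IP-set: it contains the finite sums of some sequence of positive
natural numbers. -/
def IsIPSet (S : Set ℕ) : Prop :=
  ∃ a : ℕ → ℕ, (∀ n, 0 < a n) ∧ FSseq a ⊆ S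

/-- The set `FS(A)` of finite sums of distinct elements of a set `A ⊆ ℕ`. -/
def FSset (A : Set ℕ) : Set ℕ :=
  {n | ∃ F : Finset ℕ, ↑F ⊆ A ∧ F.Nonempty ∧ n = ∑ i ∈ F, i}

/-- The spacing shift `(Σ_P, σ_P)` is topologically transitive: some point of `Σ_P`
has forward orbit (under the shift) dense in `Σ_P`. -/
def IsTransitiveShift (P : Set ℕ) : Prop :=
  ∃ x ∈ SpacingShift P, SpacingShift P ⊆ closure {y : ℕ → Bool | ∃ n : ℕ, shift^[n] x = y}

/-- `E ⊆ ℕ` is density intersective: it meets the difference set `A - A` of every set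
`A ⊆ ℕ` of positive upper Banach density. -/
def DensityIntersective (E : Set ℕ) : Prop :=
  ∀ A : Set ℕ, 0 < upperBanachDensity A → ∃ a ∈ A, ∃ a' ∈ A, a' < a ∧ a - a' ∈ E

section Recurrence

open scoped InnerProductSpace

variable {H : Type*} [NormedAddCommGroup H] [InnerProductSpace ℝ H]

/-- The subspace of vectors fixed by the `n`-th power of a linear isometry. -/
def fixedSpace (U : H →ₗᵢ[ℝ] H) (n : ℕ) : Submodule ℝ H :=
  (U ^ n).toContinuousLinearMap.eqLocus (1 : H →L[ℝ] H)

theorem mem_fixedSpace {U : H →ₗᵢ[ℝ] H} {n : ℕ} {x : H} :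
    x ∈ fixedSpace U n ↔ (U ^ n) x = x := Iff.rfl

theorem fixedSpace_mono (U : H →ₗᵢ[ℝ] H) {m n : ℕ} (h : m ∣ n) :
    fixedSpace U m ≤ fixedSpace U n := by
  obtain ⟨d, rfl⟩ := h
  intro x hx
  rw [mem_fixedSpace] at hx ⊢
  rw [pow_mul, LinearIsometry.coe_pow]
  exact Function.iterate_fixed hx d

theorem fixedSpace_pow (U : H →ₗᵢ[ℝ] H) (m n : ℕ) :
    fixedSpace (U ^ m) n = fixedSpace U (m * n) := by
  ext x
  rw [mem_fixedSpace, mem_fixedSpace, pow_mul]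

theorem isClosed_fixedSpace (U : H →ₗᵢ[ℝ] H) (n : ℕ) : IsClosed (fixedSpace U n : Set H) :=
  isClosed_eq (U ^ n).continuous continuous_id

variable [CompleteSpace H]

instance (U : H →ₗᵢ[ℝ] H) (n : ℕ) : CompleteSpace (fixedSpace U n) :=
  (isClosed_fixedSpace U n).completeSpace_coe

theorem tendsto_average_inner (U : H →ₗᵢ[ℝ] H) (n : ℕ) (v w : H) :
    Tendsto (fun K : ℕ => (K : ℝ)⁻¹ * ∑ k ∈ Finset.range K, ⟪(U ^ (n * k)) v, w⟫_ℝ) atTop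
      (𝓝 ⟪(fixedSpace U n).starProjection v, w⟫_ℝ) := by
  have h := (U ^ n).toContinuousLinearMap.tendsto_birkhoffAverage_orthogonalProjection
    (U ^ n).norm_toContinuousLinearMap_le v
  refine (h.inner (tendsto_const_nhds (x := w))).congr fun K => ?_
  rw [birkhoffAverage, birkhoffSum, real_inner_smul_left, sum_inner]
  simp [pow_mul, LinearIsometry.coe_pow]

/-- A van der Corput type estimate along the squares. -/
theorem sq_le_of_inner_pow_sq_le (U : H →ₗᵢ[ℝ] H) {f g : H} {c θ : ℝ} (hc : 0 ≤ c)
    (hf : ‖f‖ ≤ 1) (hg : ‖g‖ ≤ 1)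
    (hθ : ∀ n, 1 ≤ n → ‖(fixedSpace U n).starProjection g‖ ≤ θ)
    (h : ∀ k, 1 ≤ k → ⟪(U ^ k ^ 2) g, f⟫_ℝ ≤ -c) : c ^ 2 ≤ θ := by
  have hθ0 : 0 ≤ θ := (norm_nonneg _).trans (hθ 1 le_rfl)
  let u : ℕ → H := fun k => (U ^ (k + 1) ^ 2) g
  have hlt : ∀ a b : ℕ, b < a → ∃ l ≤ θ, Tendsto (fun K : ℕ => (K : ℝ)⁻¹ *
      ∑ k ∈ Finset.range K, ⟪u (k + a), u (k + b)⟫_ℝ) atTop (𝓝 l) := by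
    intro a b hab
    obtain ⟨d, rfl⟩ := Nat.exists_eq_add_of_lt hab
    set s := (b + d + 1 + 1) ^ 2 - (b + 1) ^ 2 with hs
    have hs' : s = (d + 1) * (2 * b + d + 3) := by
      rw [hs]; apply Nat.sub_eq_of_eq_add; ring
    refine ⟨_, ?_, (tendsto_average_inner U (2 * (d + 1)) ((U ^ s) g) g).congr fun K => ?_⟩
    · rw [Submodule.inner_starProjection_left_eq_right]
      refine (real_inner_le_norm _ _).trans ?_
      rw [LinearIsometry.norm_map]
      nlinarith [hθ (2 * (d + 1)) (by omega), norm_nonneg g,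
        norm_nonneg ((fixedSpace U (2 * (d + 1))).starProjection g)]
    · congr 1
      refine Finset.sum_congr rfl fun k _ => ?_
      have e : (k + (b + d + 1) + 1) ^ 2 = (k + b + 1) ^ 2 + (2 * (d + 1) * k + s) := by
        rw [hs']; ring
      simp only [u]
      rw [e, pow_add, pow_add U (2 * (d + 1) * k)]
      simp only [LinearIsometry.coe_mul, Function.comp_apply, LinearIsometry.inner_map_map]
  have hlim : ∀ a b : ℕ, ∃ l ≤ θ + if a = b then 1 else 0, Tendsto (fun K : ℕ => (K : ℝ)⁻¹ *
      ∑ k ∈ Finset.range K, ⟪u (k + a), u (k + b)⟫_ℝ) atTop (𝓝 l) := by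
    intro a b
    rcases lt_trichotomy a b with hab | rfl | hab
    · obtain ⟨l, hl, ht⟩ := hlt b a hab
      exact ⟨l, by simpa [hab.ne] using hl, by simpa only [real_inner_comm] using ht⟩
    · refine ⟨‖g‖ ^ 2, ?_, ?_⟩
      · rw [if_pos rfl]
        nlinarith [norm_nonneg g]
      · refine tendsto_const_nhds.congr' ?_
        filter_upwards [eventually_gt_atTop 0] with K hK
        have : (K : ℝ) ≠ 0 := by positivity
        simp [u, this]
    · obtain ⟨l, hl, ht⟩ := hlt a b hab
      exact ⟨l, by simpa [hab.ne'] using hl, ht⟩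
  choose l hl ht using hlim
  have hwin : ∀ N : ℕ, ((N : ℝ) * c) ^ 2 ≤ N * (N * θ + 1) := by
    intro N
    have hlow : ∀ k, ((N : ℝ) * c) ^ 2 ≤ ∑ a ∈ Finset.range N, ∑ b ∈ Finset.range N,
        ⟪u (k + a), u (k + b)⟫_ℝ := by
      intro k
      have h1 : ⟪∑ a ∈ Finset.range N, u (k + a), f⟫_ℝ ≤ -(N * c) := by
        rw [sum_inner]
        refine (Finset.sum_le_sum fun a _ => h (k + a + 1) (by omega)).trans ?_
        simp
      have h2 := abs_real_inner_le_norm (∑ a ∈ Finset.range N, u (k + a)) f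
      have h3 : (N : ℝ) * c ≤ ‖∑ a ∈ Finset.range N, u (k + a)‖ := by
        have := neg_le_of_abs_le h2
        nlinarith [norm_nonneg (∑ a ∈ Finset.range N, u (k + a))]
      have h4 : ∑ a ∈ Finset.range N, ∑ b ∈ Finset.range N, ⟪u (k + a), u (k + b)⟫_ℝ
          = ‖∑ a ∈ Finset.range N, u (k + a)‖ ^ 2 := by
        rw [← real_inner_self_eq_norm_sq, sum_inner]
        simp only [inner_sum]
      rw [h4]
      exact pow_le_pow_left₀ (by positivity) h3 2
    have hsum : Tendsto (fun K : ℕ => ∑ a ∈ Finset.range N, ∑ b ∈ Finset.range N,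
        ((K : ℝ)⁻¹ * ∑ k ∈ Finset.range K, ⟪u (k + a), u (k + b)⟫_ℝ)) atTop
        (𝓝 (∑ a ∈ Finset.range N, ∑ b ∈ Finset.range N, l a b)) :=
      tendsto_finsetSum _ fun a _ => tendsto_finsetSum _ fun b _ => ht a b
    have hge : ((N : ℝ) * c) ^ 2 ≤ ∑ a ∈ Finset.range N, ∑ b ∈ Finset.range N, l a b := by
      refine ge_of_tendsto hsum ?_
      filter_upwards [eventually_gt_atTop 0] with K hK
      have hK' : (K : ℝ) ≠ 0 := by positivity
      calc ((N : ℝ) * c) ^ 2 = (K : ℝ)⁻¹ * ∑ k ∈ Finset.range K, ((N : ℝ) * c) ^ 2 := by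
            simp [hK']
        _ ≤ (K : ℝ)⁻¹ * ∑ k ∈ Finset.range K, ∑ a ∈ Finset.range N, ∑ b ∈ Finset.range N,
            ⟪u (k + a), u (k + b)⟫_ℝ := by
            gcongr with k _
            exact hlow k
        _ = _ := by
            rw [Finset.sum_comm, Finset.mul_sum]
            refine Finset.sum_congr rfl fun a _ => ?_
            rw [Finset.sum_comm, Finset.mul_sum]
    refine hge.trans ?_
    calc _ ≤ ∑ a ∈ Finset.range N, ∑ b ∈ Finset.range N, (θ + if a = b then 1 else 0) :=
          Finset.sum_le_sum fun a _ => Finset.sum_le_sum fun b _ => hl a b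
      _ ≤ ∑ a ∈ Finset.range N, (N * θ + 1) := by
          refine Finset.sum_le_sum fun a ha => ?_
          simp [Finset.sum_add_distrib, Finset.mem_range.1 ha]
      _ = N * (N * θ + 1) := by rw [Finset.sum_const, Finset.card_range, nsmul_eq_mul]
  by_contra! hlt'
  obtain ⟨N, hN⟩ := exists_nat_gt (c ^ 2 - θ)⁻¹
  have hpos : 0 < c ^ 2 - θ := by linarith
  have hN0 : (0 : ℝ) < N := (inv_pos.2 hpos).trans hN
  have h1 : 1 < N * (c ^ 2 - θ) := by
    rwa [inv_lt_iff_one_lt_mul₀ hpos] at hN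
  nlinarith [hwin N]

/-- Recurrence along the squares for an isometry of a Hilbert space. -/
theorem exists_inner_pow_sq_ne_zero (U : H →ₗᵢ[ℝ] H) {e f : H} (hf : ‖f‖ ≤ 1)
    (he : ‖e‖ ≤ 1) (hUe : U e = e) (hef : 0 < ⟪e, f⟫_ℝ) :
    ∃ k : ℕ, 1 ≤ k ∧ ⟪(U ^ k ^ 2) f, f⟫_ℝ ≠ 0 := by
  by_contra! hzero
  let P : ℕ → H → H := fun n x => (fixedSpace U n).starProjection x
  set δ := ⟪e, f⟫_ℝ with hδ
  have hPlow : ∀ n, δ ≤ ‖P n f‖ := by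
    intro n
    have hen : (fixedSpace U n).starProjection e = e := by
      rw [Submodule.starProjection_eq_self_iff, mem_fixedSpace, LinearIsometry.coe_pow]
      exact Function.iterate_fixed hUe n
    calc δ = ⟪e, P n f⟫_ℝ := by
          rw [hδ, ← hen, Submodule.inner_starProjection_left_eq_right, hen]
      _ ≤ ‖e‖ * ‖P n f‖ := real_inner_le_norm _ _
      _ ≤ ‖P n f‖ := mul_le_of_le_one_left (norm_nonneg _) he
  have hPle : ∀ n, ‖P n f‖ ≤ 1 := fun n =>
    (Submodule.norm_starProjection_apply_le _ _).trans hf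
  have hPyth : ∀ m n, m ∣ n → ‖P n f - P m f‖ ^ 2 = ‖P n f‖ ^ 2 - ‖P m f‖ ^ 2 := by
    intro m n hmn
    have hcomp : P m (P n f) = P m f :=
      congrArg (fun T : H →L[ℝ] H => T f)
        (Submodule.starProjection_comp_starProjection_of_le (fixedSpace_mono U hmn))
    have hin : ⟪P n f, P m f⟫_ℝ = ‖P m f‖ ^ 2 := by
      have hidem : P m (P m f) = P m f := by
        simp only [P, Submodule.starProjection_eq_self_iff]
        exact Submodule.starProjection_apply_mem _ _
      calc ⟪P n f, P m f⟫_ℝ = ⟪P n f, P m (P m f)⟫_ℝ := by rw [hidem]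
        _ = ⟪P m (P n f), P m f⟫_ℝ := (Submodule.inner_starProjection_left_eq_right _ _ _).symm
        _ = _ := by rw [hcomp, real_inner_self_eq_norm_sq]
    rw [norm_sub_sq_real, hin]; ring
  set S : ℝ := ⨆ n : {n : ℕ // 1 ≤ n}, ‖P n f‖ ^ 2 with hS
  have hbdd : BddAbove (Set.range fun n : {n : ℕ // 1 ≤ n} => ‖P n f‖ ^ 2) :=
    ⟨1, by rintro _ ⟨n, rfl⟩; exact pow_le_one₀ (norm_nonneg _) (hPle n)⟩
  have : Nonempty {n : ℕ // 1 ≤ n} := ⟨⟨1, le_rfl⟩⟩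
  set θ : ℝ := δ ^ 4 / 2 with hθ
  have hθ0 : 0 < θ := by positivity
  obtain ⟨⟨q, hq⟩, hqS⟩ := exists_lt_of_lt_ciSup (show S - θ ^ 2 < S by nlinarith)
  have hclose : ∀ n, 1 ≤ n → q ∣ n → ‖P n f - P q f‖ ≤ θ := by
    intro n hn hqn
    refine le_of_sq_le_sq ?_ hθ0.le
    rw [hPyth q n hqn]
    have := le_ciSup hbdd ⟨n, hn⟩
    simp only at this hqS
    linarith
  have key := sq_le_of_inner_pow_sq_le (U ^ q ^ 2) (f := f) (g := f - P q f) (c := δ ^ 2) (θ := θ)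
    (by positivity) hf ?_ ?_ ?_
  · nlinarith
  · have hP0 : P 0 f = f := by
      simp only [P, Submodule.starProjection_eq_self_iff, mem_fixedSpace, pow_zero,
        LinearIsometry.coe_one, id]
    have h0 := hPyth q 0 (dvd_zero q)
    rw [hP0] at h0
    nlinarith [norm_nonneg (f - P q f), norm_nonneg f]
  · intro n hn
    simp only [fixedSpace_pow]
    have hdvd : q ∣ q ^ 2 * n := ⟨q * n, by ring⟩
    have hfix : (fixedSpace U (q ^ 2 * n)).starProjection (P q f) = P q f := by
      rw [Submodule.starProjection_eq_self_iff]
      exact fixedSpace_mono U hdvd (Submodule.starProjection_apply_mem _ _)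
    rw [map_sub, hfix]
    exact hclose _ (Nat.mul_pos (pow_pos hq 2) hn) hdvd
  · intro k hk
    have hfix : (U ^ (q * k) ^ 2) (P q f) = P q f := by
      have : P q f ∈ fixedSpace U ((q * k) ^ 2) :=
        fixedSpace_mono U ⟨q * k ^ 2, by ring⟩ (Submodule.starProjection_apply_mem _ _)
      exact this
    rw [← pow_mul, ← mul_pow, map_sub, inner_sub_left, hfix, hzero _ (Nat.mul_pos hq hk)]
    have : ⟪P q f, f⟫_ℝ = ‖P q f‖ ^ 2 := by
      have := Submodule.re_inner_starProjection_eq_normSq (fixedSpace U q) f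
      simpa using this
    rw [this]
    nlinarith [hPlow q]

/-- Recurrence along the squares for an isometry of a semi-inner product space. -/
theorem exists_inner_iterate_sq_ne_zero {E : Type*} [SeminormedAddCommGroup E]
    [InnerProductSpace ℝ E] (T : E →ₗᵢ[ℝ] E) {e f : E} (hf : ‖f‖ ≤ 1) (he : ‖e‖ ≤ 1)
    (hTe : T e = e) (hef : 0 < ⟪e, f⟫_ℝ) :
    ∃ k : ℕ, 1 ≤ k ∧ ⟪T^[k ^ 2] f, f⟫_ℝ ≠ 0 := by
  let C := T.toContinuousLinearMap.completion
  have hC : ∀ x : E, C x = T x := fun x => T.toContinuousLinearMap.completion_apply_coe x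
  have hnorm : ∀ x, ‖C x‖ = ‖x‖ := by
    intro x
    induction x using UniformSpace.Completion.induction_on with
    | hp => exact isClosed_eq (by fun_prop) (by fun_prop)
    | ih x => rw [hC, UniformSpace.Completion.norm_coe, UniformSpace.Completion.norm_coe,
        T.norm_map]
  let U : UniformSpace.Completion E →ₗᵢ[ℝ] UniformSpace.Completion E := ⟨C, hnorm⟩
  have hU : ∀ n : ℕ, (U ^ n) (f : UniformSpace.Completion E) = (T^[n] f : E) := by
    intro n
    induction n with
    | zero => rfl
    | succ n ih =>
      rw [pow_succ', LinearIsometry.coe_mul, Function.comp_apply, ih,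
        Function.iterate_succ_apply']
      exact hC _
  obtain ⟨k, hk, hne⟩ := exists_inner_pow_sq_ne_zero U (e := e) (f := f)
    (by simpa using hf) (by simpa using he) ((hC e).trans (by rw [hTe])) (by simpa using hef)
  refine ⟨k, hk, ?_⟩
  rwa [hU, UniformSpace.Completion.inner_coe] at hne

/-- Recurrence along the squares for a linear map preserving a semi-inner product. -/
theorem exists_core_inner_iterate_sq_ne_zero {V : Type*} [AddCommGroup V] [Module ℝ V]
    (B : PreInnerProductSpace.Core ℝ V) (T : V →ₗ[ℝ] V)
    (hT : ∀ v, B.inner (T v) (T v) = B.inner v v) {e f : V} (hf : B.inner f f ≤ 1)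
    (he : B.inner e e ≤ 1) (hTe : T e = e) (hef : 0 < B.inner e f) :
    ∃ k : ℕ, 1 ≤ k ∧ B.inner (T^[k ^ 2] f) f ≠ 0 := by
  let _ : SeminormedAddCommGroup V := InnerProductSpace.Core.toSeminormedAddCommGroup (c := B)
  let _ : InnerProductSpace ℝ V := InnerProductSpace.ofCore B
  have hsq : ∀ v : V, ‖v‖ ^ 2 = B.inner v v := fun v => (real_inner_self_eq_norm_sq v).symm
  have hle : ∀ v : V, B.inner v v ≤ 1 → ‖v‖ ≤ 1 := fun v hv => by
    nlinarith [hsq v, norm_nonneg v]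
  let T' : V →ₗᵢ[ℝ] V := ⟨T, fun v => by
    rw [← sq_eq_sq₀ (norm_nonneg _) (norm_nonneg _), hsq, hsq, hT]⟩
  exact exists_inner_iterate_sq_ne_zero T' (hle f hf) (hle e he) hTe hef

open scoped BoundedContinuousFunction

/-- Recurrence along the squares for an invariant positive functional on bounded functions. -/
theorem exists_mul_iterate_sq_ne_zero {X : Type*} [TopologicalSpace X] (τ : C(X, X))
    (Λ : (X →ᵇ ℝ) →ₗ[ℝ] ℝ) (hpos : ∀ F, 0 ≤ Λ (F * F))
    (hτ : ∀ F : X →ᵇ ℝ, Λ (F.compContinuous τ) = Λ F) (h1 : Λ 1 ≤ 1)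
    {f : X →ᵇ ℝ} (hff : Λ (f * f) ≤ 1) (hf : 0 < Λ f) :
    ∃ k : ℕ, 1 ≤ k ∧ ∃ x, f (τ^[k ^ 2] x) * f x ≠ 0 := by
  let B : PreInnerProductSpace.Core ℝ (X →ᵇ ℝ) :=
    { inner := fun F G => Λ (F * G)
      conj_inner_symm := fun F G => by simp [mul_comm]
      re_inner_nonneg := fun F => by simpa using hpos F
      add_left := fun F G K => by rw [add_mul, map_add]
      smul_left := fun F G r => by simp [smul_mul_assoc] }
  let T : (X →ᵇ ℝ) →ₗ[ℝ] (X →ᵇ ℝ) :=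
    { toFun := fun F => F.compContinuous τ
      map_add' := fun F G => rfl
      map_smul' := fun r F => rfl }
  have hTn : ∀ (n : ℕ) (x : X), (T^[n] f) x = f (τ^[n] x) := by
    intro n
    induction n with
    | zero => exact fun x => rfl
    | succ n ih =>
      intro x
      rw [Function.iterate_succ_apply', Function.iterate_succ_apply, ← ih]
      rfl
  obtain ⟨k, hk, hne⟩ := exists_core_inner_iterate_sq_ne_zero B T (e := 1) (f := f)
    (fun F => hτ (F * F)) hff ((congrArg Λ (mul_one 1)).trans_le h1) rfl
    (hf.trans_eq (congrArg Λ (one_mul f)).symm)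
  refine ⟨k, hk, ?_⟩
  by_contra! hzero
  refine hne ?_
  have : T^[k ^ 2] f * f = 0 := by
    ext x
    rw [BoundedContinuousFunction.mul_apply, hTn, hzero]
    rfl
  change Λ (T^[k ^ 2] f * f) = 0
  rw [this, map_zero]


/-- **Furstenberg-Sárközy theorem**: large subsets of long intervals contain two elements whose
difference is a positive square. -/
theorem eventually_card_le_of_sub_ne_sq {ε : ℝ} (hε : 0 < ε) :
    ∃ N₀ : ℕ, ∀ N ≥ N₀, ∀ A ⊆ Finset.range N,
      (∀ i ∈ A, ∀ k, 1 ≤ k → i + k ^ 2 ∉ A) → (A.card : ℝ) ≤ ε * N := by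
  classical
  by_contra! hcon
  choose N hN A hAN hA hcard using hcon
  have hNtop : Tendsto N atTop atTop := tendsto_atTop_mono hN tendsto_id
  let 𝒰 : Ultrafilter ℕ := Ultrafilter.of atTop
  have h𝒰 : (𝒰 : Filter ℕ) ≤ atTop := Ultrafilter.of_le atTop
  let avg : ((ℕ × ℕ) →ᵇ ℝ) → ℕ → ℝ := fun F n =>
    (N n : ℝ)⁻¹ * ∑ x ∈ Finset.range (N n), F (n, x)
  have hcast : Tendsto (fun n => (N n : ℝ)⁻¹) atTop (𝓝 0) :=
    tendsto_inv_atTop_zero.comp (tendsto_natCast_atTop_atTop.comp hNtop)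
  have havg : ∀ F n, |avg F n| ≤ ‖F‖ := by
    intro F n
    rcases Nat.eq_zero_or_pos (N n) with h0 | h0
    · simp [avg, h0]
    · have h0' : (0 : ℝ) < N n := by exact_mod_cast h0
      rw [abs_mul, abs_inv, Nat.abs_cast, inv_mul_le_iff₀ h0']
      refine (Finset.abs_sum_le_sum_abs _ _).trans ?_
      refine (Finset.sum_le_sum fun x _ => F.norm_coe_le_norm (n, x)).trans ?_
      simp
  have hex : ∀ F, ∃ l, Tendsto (avg F) 𝒰 (𝓝 l) := by
    intro F
    obtain ⟨l, -, hl⟩ := (isCompact_Icc (a := -‖F‖) (b := ‖F‖)).ultrafilter_le_nhds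
      (𝒰.map (avg F))
      (le_principal_iff.2 (Filter.mem_map.2 (Filter.univ_mem' fun n => abs_le.1 (havg F n))))
    exact ⟨l, hl⟩
  choose Λ hΛ using hex
  let Λ' : ((ℕ × ℕ) →ᵇ ℝ) →ₗ[ℝ] ℝ :=
    { toFun := Λ
      map_add' := fun F G => tendsto_nhds_unique (hΛ (F + G)) <|
        ((hΛ F).add (hΛ G)).congr fun n => by simp [avg, Finset.sum_add_distrib, mul_add]
      map_smul' := fun r F => tendsto_nhds_unique (hΛ (r • F)) <|
        ((hΛ F).const_mul r).congr fun n => by simp [avg, ← Finset.mul_sum, mul_left_comm] }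
  let τ : C(ℕ × ℕ, ℕ × ℕ) := ⟨fun p => (p.1, p.2 + 1), continuous_of_discreteTopology⟩
  have hτ : ∀ F : (ℕ × ℕ) →ᵇ ℝ, Λ (F.compContinuous τ) = Λ F := by
    intro F
    have hdiff : Tendsto (fun n => avg (F.compContinuous τ) n - avg F n) atTop (𝓝 0) := by
      refine squeeze_zero_norm (fun n => ?_)
        (by simpa using hcast.mul_const (‖F‖ + ‖F‖))
      have : avg (F.compContinuous τ) n - avg F n = (N n : ℝ)⁻¹ * (F (n, N n) - F (n, 0)) := by
        rw [← Finset.sum_range_sub (fun x => F (n, x)), Finset.sum_sub_distrib, mul_sub]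
        rfl
      rw [this, norm_mul, norm_inv, Real.norm_natCast]
      gcongr
      refine (norm_sub_le _ _).trans ?_
      gcongr <;> exact F.norm_coe_le_norm _
    have := tendsto_nhds_unique ((hΛ (F.compContinuous τ)).sub (hΛ F)) (hdiff.mono_left h𝒰)
    linarith
  let f : (ℕ × ℕ) →ᵇ ℝ := BoundedContinuousFunction.ofNormedAddCommGroupDiscrete
    (fun p => if p.2 ∈ A p.1 then 1 else 0) 1 fun p => by split_ifs <;> simp
  have hfapp : ∀ n x, f (n, x) = if x ∈ A n then 1 else 0 := fun n x => rfl
  have hfavg : ∀ n, avg f n = (N n : ℝ)⁻¹ * (A n).card := by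
    intro n
    simp only [avg, hfapp]
    rw [Finset.sum_ite_mem, Finset.inter_eq_right.2 (hAN n)]
    simp
  have hnorm_le : ∀ F, ‖F‖ ≤ 1 → Λ F ≤ 1 := fun F hF =>
    le_of_tendsto (hΛ F) (.of_forall fun n => (le_abs_self _).trans ((havg F n).trans hF))
  have hf1 : ‖f‖ ≤ 1 :=
    BoundedContinuousFunction.norm_ofNormedAddCommGroup_le _ zero_le_one _
  obtain ⟨k, hk, ⟨n, x⟩, hne⟩ := exists_mul_iterate_sq_ne_zero τ Λ' (f := f)
    (fun F => ge_of_tendsto (hΛ (F * F)) (.of_forall fun n =>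
      mul_nonneg (by positivity) (Finset.sum_nonneg fun x _ => mul_self_nonneg (F (n, x)))))
    hτ (hnorm_le 1 (by simp))
    (hnorm_le _ ((norm_mul_le f f).trans (mul_le_one₀ hf1 (norm_nonneg _) hf1)))
    (hε.trans_le (ge_of_tendsto (hΛ f) (by
      filter_upwards [h𝒰 (hNtop.eventually_gt_atTop 0)] with n hn
      have hn' : (0 : ℝ) < N n := by exact_mod_cast hn
      rw [hfavg, le_inv_mul_iff₀ hn', mul_comm]
      exact (hcard n).le)))
  have hτn : ∀ m : ℕ, τ^[m] (n, x) = (n, x + m) := by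
    intro m
    induction m with
    | zero => rfl
    | succ m ih => rw [Function.iterate_succ_apply', ih]; rfl
  rw [hτn, hfapp, hfapp] at hne
  by_cases hx : x ∈ A n
  · simp [hA n x hx k hk] at hne
  · simp [hx] at hne

end Recurrence

open Classical in
/-- The subsets of `{0, …, N - 1}` without two elements differing by a positive square. -/
noncomputable def squareFreeDiffSets (N : ℕ) : Finset (Finset ℕ) :=
  {A ∈ (Finset.range N).powerset | ∀ i ∈ A, ∀ k, 1 ≤ k → i + k ^ 2 ∉ A}

theorem mem_squareFreeDiffSets {N : ℕ} {A : Finset ℕ} : A ∈ squareFreeDiffSets N ↔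
    A ⊆ Finset.range N ∧ ∀ i ∈ A, ∀ k, 1 ≤ k → i + k ^ 2 ∉ A := by
  simp [squareFreeDiffSets]

theorem exists_card_squareFreeDiffSets_le {η : ℝ} (hη : 0 < η) :
    ∃ C : ℝ, ∀ N, ((squareFreeDiffSets N).card : ℝ) ≤ C * Real.exp η ^ N := by
  set t : ℝ := min (η / 2) 1 with ht
  have ht0 : 0 < t := lt_min (by positivity) one_pos
  have hlog : 0 ≤ -Real.log t := neg_nonneg.2 (Real.log_nonpos ht0.le (min_le_right _ _))
  set ε : ℝ := η / 2 / (-Real.log t + 1) with hε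
  have hε0 : 0 < ε := by positivity
  have hεle : ε * (-Real.log t) ≤ η / 2 := by
    rw [hε, div_mul_eq_mul_div, div_le_iff₀ (by positivity)]
    nlinarith
  obtain ⟨N₀, hN₀⟩ := eventually_card_le_of_sub_ne_sq hε0
  refine ⟨2 ^ N₀, fun N => ?_⟩
  have hone : 1 ≤ Real.exp η ^ N := one_le_pow₀ (Real.one_le_exp hη.le)
  rcases lt_or_ge N N₀ with hlt | hge
  · have hsub : squareFreeDiffSets N ⊆ (Finset.range N).powerset := fun A hA =>
      Finset.mem_powerset.2 (mem_squareFreeDiffSets.1 hA).1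
    have hcard : ((squareFreeDiffSets N).card : ℝ) ≤ 2 ^ N := by
      have := Finset.card_le_card hsub
      rw [Finset.card_powerset, Finset.card_range] at this
      exact_mod_cast this
    calc ((squareFreeDiffSets N).card : ℝ) ≤ 2 ^ N := hcard
      _ ≤ 2 ^ N₀ := pow_le_pow_right₀ one_le_two hlt.le
      _ ≤ 2 ^ N₀ * Real.exp η ^ N := le_mul_of_one_le_right (by positivity) hone
  · have hweight : ((squareFreeDiffSets N).card : ℝ) * Real.exp (-(η / 2 * N)) ≤ (1 + t) ^ N := by
      rw [← nsmul_eq_mul, ← Finset.sum_const]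
      calc ∑ A ∈ squareFreeDiffSets N, Real.exp (-(η / 2 * N))
          ≤ ∑ A ∈ squareFreeDiffSets N, t ^ A.card := by
            refine Finset.sum_le_sum fun A hA => ?_
            obtain ⟨hAN, hA'⟩ := mem_squareFreeDiffSets.1 hA
            rw [← Real.exp_log ht0, ← Real.exp_nat_mul, Real.exp_le_exp]
            have := hN₀ N hge A hAN hA'
            nlinarith [mul_le_mul_of_nonneg_right this hlog,
              mul_le_mul_of_nonneg_right hεle (Nat.cast_nonneg (α := ℝ) N)]
        _ ≤ ∑ A ∈ (Finset.range N).powerset, t ^ A.card :=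
            Finset.sum_le_sum_of_subset_of_nonneg
              (fun A hA => Finset.mem_powerset.2 (mem_squareFreeDiffSets.1 hA).1)
              fun _ _ _ => by positivity
        _ = (1 + t) ^ N := by
            have := Finset.sum_pow_mul_eq_add_pow t 1 (Finset.range N)
            simpa [add_comm] using this
    have hpow : (1 + t) ^ N ≤ Real.exp (η / 2 * N) := by
      rw [mul_comm, Real.exp_nat_mul]
      gcongr
      linarith [Real.add_one_le_exp (η / 2), min_le_left (η / 2) 1]
    calc ((squareFreeDiffSets N).card : ℝ)
        = (squareFreeDiffSets N).card * Real.exp (-(η / 2 * N)) * Real.exp (η / 2 * N) := by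
          rw [mul_assoc, ← Real.exp_add, neg_add_cancel, Real.exp_zero, mul_one]
      _ ≤ Real.exp (η / 2 * N) * Real.exp (η / 2 * N) := by
          gcongr
          exact hweight.trans hpow
      _ = Real.exp η ^ N := by
          rw [← Real.exp_add, ← Real.exp_nat_mul]
          ring_nf
      _ ≤ 2 ^ N₀ * Real.exp η ^ N :=
          le_mul_of_one_le_left (by positivity) (one_le_pow₀ one_le_two)

theorem shift_iterate_apply (k : ℕ) (x : ℕ → Bool) (i : ℕ) : shift^[k] x i = x (i + k) := by
  induction k generalizing x with
  | zero => rfl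
  | succ k ih => rw [Function.iterate_succ_apply, ih]; rfl

theorem exists_forall_lt_eq_mem_of_mem_uniformity {U : Set ((ℕ → Bool) × (ℕ → Bool))}
    (hU : U ∈ uniformity (ℕ → Bool)) :
    ∃ m : ℕ, ∀ x y : ℕ → Bool, (∀ i < m, x i = y i) → (x, y) ∈ U := by
  rw [Pi.uniformity, mem_iInf] at hU
  obtain ⟨I, hI, V, hV, rfl⟩ := hU
  obtain ⟨m, hm⟩ := hI.bddAbove
  refine ⟨m + 1, fun x y hxy => Set.mem_iInter.2 fun i => ?_⟩
  obtain ⟨W, hW, hWV⟩ := mem_comap.1 (hV i)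
  refine hWV ?_
  change (x i, y i) ∈ W
  rw [hxy i (Nat.lt_succ_of_le (hm i.2))]
  exact mem_uniformity_of_eq hW rfl

open Classical in
theorem isDynCoverOf_squareFreeDiffSets {U : Set ((ℕ → Bool) × (ℕ → Bool))} {m : ℕ}
    (hm : ∀ x y : ℕ → Bool, (∀ i < m, x i = y i) → (x, y) ∈ U) (n : ℕ) :
    Dynamics.IsDynCoverOf shift (SpacingShift {n : ℕ | ∃ k : ℕ, 1 ≤ k ∧ n = k ^ 2}ᶜ) U n
      ((squareFreeDiffSets (n + m)).image fun A i => decide (i ∈ A) : Finset (ℕ → Bool)) := by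
  intro x hx
  refine ⟨fun i => decide (i ∈ {j ∈ Finset.range (n + m) | x j = true}), ?_, ?_⟩
  · rw [Finset.mem_coe]
    refine Finset.mem_image_of_mem (fun (A : Finset ℕ) (i : ℕ) => decide (i ∈ A))
      (mem_squareFreeDiffSets.2 ⟨Finset.filter_subset _ _, fun i hi k hk hik => ?_⟩)
    have hpos : 0 < k ^ 2 := by positivity
    exact hx i (i + k ^ 2) (by omega) (Finset.mem_filter.1 hi).2 (Finset.mem_filter.1 hik).2
      ⟨k, hk, by omega⟩
  · rw [Dynamics.mem_dynEntourage]
    refine fun k hk => hm _ _ fun i hi => ?_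
    rw [shift_iterate_apply, shift_iterate_apply]
    simp [show i + k < n + m by omega]

open Classical in
theorem coverEntropy_spacingShift_nonsquares :
    Dynamics.coverEntropy shift
      (SpacingShift {n : ℕ | ∃ k : ℕ, 1 ≤ k ∧ n = k ^ 2}ᶜ) = 0 := by
  refine le_antisymm (iSup₂_le fun U hU => ?_)
    (Dynamics.coverEntropy_nonneg _ ⟨fun _ => false, fun i j _ h => by simp at h⟩)
  obtain ⟨m, hm⟩ := exists_forall_lt_eq_mem_of_mem_uniformity hU
  refine EReal.le_of_forall_lt_iff_le.1 fun η hη => ?_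
  have hη' : 0 < η := by exact_mod_cast hη
  obtain ⟨C, hC⟩ := exists_card_squareFreeDiffSets_le hη'
  have hC0 : 0 ≤ C := by simpa using (Nat.cast_nonneg _).trans (hC 0)
  have hle : ∀ n : ℕ, ((Dynamics.coverMincard shift
      (SpacingShift {n : ℕ | ∃ k : ℕ, 1 ≤ k ∧ n = k ^ 2}ᶜ) U n : ℕ∞) : ENNReal) ≤
      ENNReal.ofReal (C * Real.exp η ^ m) * ENNReal.ofReal (Real.exp η) ^ n := by
    intro n
    have h1 := (isDynCoverOf_squareFreeDiffSets hm n).coverMincard_le_card.trans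
      (Nat.cast_le.2 Finset.card_image_le)
    have h2 : (squareFreeDiffSets (n + m)).card ≤ C * Real.exp η ^ m * Real.exp η ^ n := by
      rw [mul_assoc, ← pow_add, add_comm m n]
      exact hC (n + m)
    rw [← ENNReal.ofReal_pow (Real.exp_pos η).le, ← ENNReal.ofReal_mul (by positivity)]
    calc _ ≤ (((squareFreeDiffSets (n + m)).card : ℕ∞) : ENNReal) := ENat.toENNReal_le.2 h1
      _ = ENNReal.ofReal (squareFreeDiffSets (n + m)).card := by simp
      _ ≤ _ := ENNReal.ofReal_le_ofReal h2
  refine (ExpGrowth.expGrowthSup_le_of_eventually_le ENNReal.ofReal_ne_top (.of_forall hle)).trans ?_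
  rw [ExpGrowth.expGrowthSup_pow, ENNReal.log_ofReal_of_pos (Real.exp_pos η), Real.log_exp]

theorem isDeltaStarSet_compl_squares :
    IsDeltaStarSet {n : ℕ | ∃ k : ℕ, 1 ≤ k ∧ n = k ^ 2}ᶜ := by
  rintro D ⟨s, hs, hD⟩
  by_contra hne
  have hsq : ∀ i j, j < i → ∃ k, s i - s j = k ^ 2 := by
    intro i j hij
    by_contra hk
    refine hne ⟨s i - s j, ?_, hD i j hij⟩
    rintro ⟨k, -, h⟩
    exact hk ⟨k, h⟩
  have h01 : s 0 < s 1 := hs one_pos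
  set d := s 1 - s 0 with hd
  obtain ⟨a, ha⟩ := hsq (s 1 + d ^ 2 + 2) 0 (by omega)
  obtain ⟨b, hb⟩ := hsq (s 1 + d ^ 2 + 2) 1 (by omega)
  have hid := hs.id_le (s 1 + d ^ 2 + 2)
  simp only [id] at hid
  have hab : a ^ 2 = b ^ 2 + d := by omega
  have hlt : b < a := by
    by_contra! h
    have := Nat.pow_le_pow_left h 2
    omega
  have hdb : d ^ 2 < b ^ 2 := by omega
  have := lt_of_pow_lt_pow_left₀ 2 (Nat.zero_le b) hdb
  nlinarith [Nat.pow_le_pow_left hlt 2]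

/-- `P = ℕ \ {n² : n ≥ 1}` is a Δ*-set, yet `h_{σ_P} = 0`. -/
theorem nonsquares_deltaStar_and_entropy_zero :
    IsDeltaStarSet {n : ℕ | ∃ k : ℕ, 1 ≤ k ∧ n = k ^ 2}ᶜ ∧
      Dynamics.coverEntropy shift
        (SpacingShift {n : ℕ | ∃ k : ℕ, 1 ≤ k ∧ n = k ^ 2}ᶜ) = 0 :=
  ⟨isDeltaStarSet_compl_squares, coverEntropy_spacingShift_nonsquares⟩
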